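/- (Homogeneity of the resultant.) For each fixed index j with 0 ≤ j ≤ n, the resultant Res_{d_0,...,d_n} is homogeneous in the variables u_{j,α}, |α| = d_j, of degree d_0 ⋯ d_{j-1} d_{j+1} ⋯ d_n (the product of all d_i with i ≠ j); hence the total degree of Res_{d_0,...,d_n} equals Σ_{j=0}^{n} d_0 ⋯ d_{j-1} d_{j+1} ⋯ d_n. -/

import Mathlib

open MvPolynomial

/-- `Mono m e` is the type of exponent vectors of total degree `e` in `m` variables. -/
abbrev Mono (m e : ℕ) : Type := {α : Fin m → ℕ // ∑ j, α j = e}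

instance (m e : ℕ) : Fintype (Mono m e) :=
  Fintype.subtype (Finset.Nat.antidiagonalTuple m e) fun _ => Finset.Nat.mem_antidiagonalTuple

/-- The exponent vector as a finitely supported function (a monomial of `MvPolynomial`). -/
noncomputable abbrev Mono.toFinsupp {m e : ℕ} (α : Mono m e) : Fin m →₀ ℕ :=
  Finsupp.equivFunOnFinite.symm α.1

/-- The index type for the variables `u_{i,α}` of the universal ring of coefficients
`ℤ[u_{i,α} : i, |α| = d i]` for `m` forms of degrees `d 0, …, d (m-1)` in `m` variables. -/
abbrev CoeffIdx (m : ℕ) (d : Fin m → ℕ) : Type := Σ i : Fin m, Mono m (d i)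

/-- Evaluation `P ↦ P(F_0, …, F_{m-1})` : each universal variable `u_{i,α}` is replaced by the
corresponding coefficient `c_{i,α}` of `F_i`. -/
noncomputable def resEval {m : ℕ} (d : Fin m → ℕ) (F : Fin m → MvPolynomial (Fin m) ℂ)
    (R : MvPolynomial (CoeffIdx m d) ℤ) : ℂ :=
  eval₂ (Int.castRingHom ℂ) (fun v => coeff v.2.toFinsupp (F v.1)) R

/-- `IsResultant m d R` says that `R` is *the* resultant polynomial `Res_{d_0,…,d_n}` (`m = n+1`):
(1) for homogeneous `F_i` of degrees `d i`, the system `F_0 = ⋯ = F_n = 0` has a nontrivial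
solution over `ℂ` iff `R(F_0,…,F_n) = 0`; (2) `R` is irreducible, even over `ℂ`;
(3) `R(x_0^{d_0},…,x_n^{d_n}) = 1`. -/
def IsResultant (m : ℕ) (d : Fin m → ℕ) (R : MvPolynomial (CoeffIdx m d) ℤ) : Prop :=
  (∀ F : Fin m → MvPolynomial (Fin m) ℂ, (∀ i, (F i).IsHomogeneous (d i)) →
    ((∃ x : Fin m → ℂ, x ≠ 0 ∧ ∀ i, eval x (F i) = 0) ↔ resEval d F R = 0)) ∧
  Irreducible R ∧ Irreducible (MvPolynomial.map (Int.castRingHom ℂ) R) ∧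
  resEval d (fun i => X i ^ d i) R = 1

section Grading

variable {σ K : Type*} [Field K]

/-- The homomorphism `u_v ↦ u_v t` for `v ∈ s` and `u_v ↦ u_v` for `v ∉ s`, which records the degree
in the block of variables `s` as an exponent of `t`. -/
noncomputable def blockGrading [DecidableEq σ] (s : Finset σ) :
    MvPolynomial σ K →ₐ[K] Polynomial (MvPolynomial σ K) :=
  aeval fun v => Polynomial.C (X v) * Polynomial.X ^ (if v ∈ s then 1 else 0)

theorem blockGrading_monomial [Fintype σ] [DecidableEq σ] (s : Finset σ) (μ : σ →₀ ℕ) (a : K) :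
    blockGrading s (monomial μ a) =
      Polynomial.C (monomial μ a) * Polynomial.X ^ (∑ v ∈ s, μ v) := by
  have h1 : ∑ v ∈ s, μ v = ∑ v, (if v ∈ s then 1 else 0) * μ v := by simp
  rw [blockGrading, aeval_monomial, Finsupp.prod_fintype _ _ (by simp), monomial_eq,
    Finsupp.prod_fintype _ _ (by simp), h1, ← Finset.prod_pow_eq_pow_sum]
  simp only [mul_pow, ← pow_mul, Finset.prod_mul_distrib, map_mul, map_prod, map_pow]
  rw [mul_assoc]
  rfl

theorem coeff_coeff_blockGrading [Fintype σ] [DecidableEq σ] (s : Finset σ)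
    (p : MvPolynomial σ K) (k : ℕ) (μ : σ →₀ ℕ) :
    coeff μ ((blockGrading s p).coeff k) = if ∑ v ∈ s, μ v = k then coeff μ p else 0 := by
  induction p using MvPolynomial.induction_on' with
  | monomial ν a =>
    rw [blockGrading_monomial, Polynomial.coeff_C_mul, Polynomial.coeff_X_pow, coeff_monomial]
    by_cases h : ν = μ
    · subst h
      split_ifs <;> simp_all
    · split_ifs <;> simp_all
  | add p q hp hq =>
    rw [map_add, Polynomial.coeff_add, coeff_add, hp, hq]
    split_ifs <;> simp

theorem exists_block_degree_of_dvd [Fintype σ] [DecidableEq σ] (s : Finset σ) {p q : MvPolynomial σ K}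
    (hq : q ≠ 0) {N : ℕ} (hN : blockGrading s q = Polynomial.C q * Polynomial.X ^ N) (hpq : p ∣ q) :
    ∃ D ≤ N, ∀ μ ∈ p.support, ∑ v ∈ s, μ v = D := by
  obtain ⟨r, rfl⟩ := hpq
  set P := blockGrading s p
  set Q := blockGrading s r
  have hPQ : P * Q = Polynomial.C (p * r) * Polynomial.X ^ N := by rw [← hN, map_mul]
  have hne : P * Q ≠ 0 := by
    rw [hPQ, Polynomial.C_mul_X_pow_eq_monomial]
    simpa using hq
  have hP : P ≠ 0 := left_ne_zero_of_mul hne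
  have hQ : Q ≠ 0 := right_ne_zero_of_mul hne
  have h1 : P.natDegree + Q.natDegree = N := by
    rw [← Polynomial.natDegree_mul hP hQ, hPQ, Polynomial.natDegree_C_mul_X_pow _ _ hq]
  have h2 : P.natTrailingDegree + Q.natTrailingDegree = N := by
    rw [← Polynomial.natTrailingDegree_mul hP hQ, hPQ, Polynomial.C_mul_X_pow_eq_monomial,
      Polynomial.natTrailingDegree_monomial hq]
  have h3 := Polynomial.natTrailingDegree_le_natDegree P
  have h4 := Polynomial.natTrailingDegree_le_natDegree Q
  refine ⟨P.natDegree, by omega, fun μ hμ => ?_⟩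
  have h5 : P.coeff (∑ v ∈ s, μ v) ≠ 0 := by
    intro h
    have := coeff_coeff_blockGrading s p (∑ v ∈ s, μ v) μ
    rw [if_pos rfl] at this
    rw [mem_support_iff, ← this] at hμ
    exact hμ (by rw [show blockGrading s p = P from rfl, h, coeff_zero])
  have h6 := Polynomial.le_natDegree_of_ne_zero h5
  have h7 := Polynomial.natTrailingDegree_le_of_ne_zero h5
  omega

theorem natDegree_aeval_le_of_block_degree_le [Fintype σ] [DecidableEq σ] (s : Finset σ)
    (p : MvPolynomial σ K) (D : ℕ) (hD : ∀ μ ∈ p.support, ∑ v ∈ s, μ v ≤ D)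
    (q : σ → Polynomial K) (hq : ∀ v, (q v).natDegree ≤ if v ∈ s then 1 else 0) :
    (aeval q p).natDegree ≤ D := by
  rw [aeval_def, eval₂_eq']
  refine Polynomial.natDegree_sum_le_of_forall_le _ _ fun μ hμ => ?_
  refine (Polynomial.natDegree_C_mul_le _ _).trans ?_
  refine (Polynomial.natDegree_prod_le _ _).trans (le_trans ?_ (hD μ hμ))
  calc ∑ v, (q v ^ μ v).natDegree ≤ ∑ v, (if v ∈ s then μ v else 0) := by
        refine Finset.sum_le_sum fun v _ => Polynomial.natDegree_pow_le.trans ?_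
        have := Nat.mul_le_mul_left (μ v) (hq v)
        split_ifs at this ⊢ <;> simpa using this
    _ = ∑ v ∈ s, μ v := by simp

/-- The Nullstellensatz for a prime principal ideal. -/
theorem dvd_of_irreducible_of_forall_eval_eq_zero [Finite σ] [IsAlgClosed K]
    {p q : MvPolynomial σ K} (hp : Irreducible p) (h : ∀ c, eval c p = 0 → eval c q = 0) :
    p ∣ q := by
  have hprime : (Ideal.span {p}).IsPrime :=
    (Ideal.span_singleton_prime hp.ne_zero).2 hp.prime
  have hmem : q ∈ vanishingIdeal K (zeroLocus K (Ideal.span {p})) := by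
    intro c hc
    rw [aeval_eq_eval]
    refine h c ?_
    have := hc p (Ideal.subset_span rfl)
    rwa [aeval_eq_eval] at this
  rw [vanishingIdeal_zeroLocus_eq_radical, hprime.radical] at hmem
  exact Ideal.mem_span_singleton.1 hmem

end Grading

section Macaulay

variable {m : ℕ} (d : Fin m → ℕ)

/-- The degree `∑ (d_i - 1) + 1` in which the Macaulay matrix is formed. -/
abbrev macaulayDegree : ℕ := ∑ i, (d i - 1) + 1

variable {d}

theorem exists_le_of_macaulayDegree (β : Mono m (macaulayDegree d)) : ∃ i, d i ≤ β.1 i := by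
  by_contra! h
  have h1 : ∑ i, β.1 i ≤ ∑ i, (d i - 1) :=
    Finset.sum_le_sum fun i _ => Nat.le_sub_one_of_lt (h i)
  have h2 := β.2
  unfold macaulayDegree at h2
  omega

open Classical in
/-- An index `i` with `x_i ^ d_i` dividing the monomial `x ^ β`, different from `j` if possible. -/
noncomputable def macaulayIndex (j : Fin m) (β : Mono m (macaulayDegree d)) : Fin m :=
  if h : ∃ i, i ≠ j ∧ d i ≤ β.1 i then h.choose else j

theorem le_macaulayIndex (j : Fin m) (β : Mono m (macaulayDegree d)) :
    d (macaulayIndex j β) ≤ β.1 (macaulayIndex j β) := by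
  unfold macaulayIndex
  split_ifs with h
  · exact h.choose_spec.2
  · obtain ⟨i, hi⟩ := exists_le_of_macaulayDegree β
    by_cases hij : i = j
    · exact hij ▸ hi
    · exact absurd ⟨i, hij, hi⟩ h

theorem lt_of_macaulayIndex_eq {j : Fin m} {β : Mono m (macaulayDegree d)}
    (h : macaulayIndex j β = j) {i : Fin m} (hi : i ≠ j) : β.1 i < d i := by
  by_contra! hle
  have hex : ∃ i, i ≠ j ∧ d i ≤ β.1 i := ⟨i, hi, hle⟩
  rw [macaulayIndex, dif_pos hex] at h
  exact hex.choose_spec.1 h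

/-- The number of monomials in the block `j` of the Macaulay matrix is at most `∏_{i ≠ j} d_i`. -/
theorem card_macaulayIndex_eq_le (j : Fin m) :
    (Finset.univ.filter fun β : Mono m (macaulayDegree d) => macaulayIndex j β = j).card ≤
      ∏ i ∈ Finset.univ.erase j, d i := by
  have hcard : (Fintype.piFinset fun i => if i = j then {0} else Finset.range (d i)).card =
      ∏ i ∈ Finset.univ.erase j, d i := by
    rw [Fintype.card_piFinset, ← Finset.mul_prod_erase _ _ (Finset.mem_univ j)]
    simp only [if_true, Finset.card_singleton, one_mul]
    refine Finset.prod_congr rfl fun i hi => ?_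
    rw [if_neg (Finset.ne_of_mem_erase hi), Finset.card_range]
  rw [← hcard]
  refine Finset.card_le_card_of_injOn (fun β => Function.update β.1 j 0) ?_ ?_
  · intro β hβ
    have hβ' : macaulayIndex j β = j := by simpa using hβ
    rw [Finset.mem_coe, Fintype.mem_piFinset]
    intro i
    by_cases hi : i = j
    · subst hi; simp
    · simpa [hi] using lt_of_macaulayIndex_eq hβ' hi
  · intro β _ γ _ h
    have hne : ∀ i, i ≠ j → β.1 i = γ.1 i := fun i hi => by
      simpa [hi] using congrFun h i
    have hj : β.1 j = γ.1 j := by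
      have h1 := β.2.trans γ.2.symm
      rw [← Finset.add_sum_erase _ _ (Finset.mem_univ j),
        ← Finset.add_sum_erase _ _ (Finset.mem_univ j),
        Finset.sum_congr rfl fun i hi => hne i (Finset.ne_of_mem_erase hi)] at h1
      exact Nat.add_right_cancel h1
    ext i
    by_cases hi : i = j
    · rw [hi, hj]
    · exact hne i hi

/-- The exponent of `x ^ β / x_i ^ d_i`, where `i` is the Macaulay index of `β`. -/
noncomputable def macaulayQuotient (j : Fin m) (β : Mono m (macaulayDegree d)) : Fin m → ℕ :=
  β.1 - Pi.single (macaulayIndex j β) (d (macaulayIndex j β))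

theorem single_add_macaulayQuotient (j : Fin m) (β : Mono m (macaulayDegree d)) :
    Pi.single (macaulayIndex j β) (d (macaulayIndex j β)) + macaulayQuotient j β = β.1 := by
  refine add_tsub_cancel_of_le fun i => ?_
  by_cases hi : i = macaulayIndex j β
  · rw [hi, Pi.single_eq_same]
    exact le_macaulayIndex j β
  · simp [Pi.single_eq_of_ne hi]

theorem sum_add_macaulayQuotient (j : Fin m) (β : Mono m (macaulayDegree d))
    (α : Mono m (d (macaulayIndex j β))) :
    ∑ i, (α.1 + macaulayQuotient j β) i = macaulayDegree d := by
  have h := β.2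
  rw [← single_add_macaulayQuotient j β] at h
  simp only [Pi.add_apply, Finset.sum_add_distrib, Finset.sum_pi_single', Finset.mem_univ,
    if_true, α.2] at h ⊢
  exact h

/-- The Macaulay matrix: the row indexed by `β` holds the coefficients of
`(x ^ β / x_i ^ d_i) F_i`, where `i` is the Macaulay index of `β`. -/
noncomputable def macaulayMatrix (j : Fin m) :
    Matrix (Mono m (macaulayDegree d)) (Mono m (macaulayDegree d))
      (MvPolynomial (CoeffIdx m d) ℂ) :=
  Matrix.of fun β γ => ∑ α : Mono m (d (macaulayIndex j β)),
    if α.1 + macaulayQuotient j β = γ.1 then X ⟨macaulayIndex j β, α⟩ else 0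

theorem eval_det_macaulayMatrix (j : Fin m) (c : CoeffIdx m d → ℂ) :
    eval c (macaulayMatrix (d := d) j).det = ((macaulayMatrix j).map (eval c)).det :=
  RingHom.map_det _ _

theorem blockGrading_det_macaulayMatrix (j : Fin m) :
    blockGrading (Finset.univ.filter fun v : CoeffIdx m d => v.1 = j) (macaulayMatrix j).det =
      Polynomial.C (macaulayMatrix j).det * Polynomial.X ^
        (Finset.univ.filter fun β : Mono m (macaulayDegree d) => macaulayIndex j β = j).card := by
  set s := Finset.univ.filter fun v : CoeffIdx m d => v.1 = j
  have hmap : (blockGrading s).mapMatrix (macaulayMatrix j) = Matrix.of fun β γ =>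
      (Polynomial.X ^ (if macaulayIndex j β = j then 1 else 0)) *
        (Polynomial.C.mapMatrix (macaulayMatrix (d := d) j)) β γ := by
    ext1 β γ
    simp only [AlgHom.mapMatrix_apply, Matrix.map_apply, macaulayMatrix, Matrix.of_apply,
      RingHom.mapMatrix_apply, map_sum, Finset.mul_sum]
    refine Finset.sum_congr rfl fun α _ => ?_
    split_ifs with h1 h2 <;> simp [blockGrading, s, *]
  rw [AlgHom.map_det, hmap, Matrix.det_mul_column, ← RingHom.map_det, Finset.prod_pow_eq_pow_sum,
    ← Finset.card_filter, mul_comm]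

theorem eval_det_macaulayMatrix_eq_zero (j : Fin m) (c : CoeffIdx m d → ℂ) {x : Fin m → ℂ}
    (hx : x ≠ 0) (h : ∀ i, ∑ α : Mono m (d i), c ⟨i, α⟩ * ∏ k, x k ^ α.1 k = 0) :
    eval c (macaulayMatrix (d := d) j).det = 0 := by
  rw [eval_det_macaulayMatrix, ← Matrix.exists_mulVec_eq_zero_iff]
  refine ⟨fun γ => ∏ k, x k ^ γ.1 k, ?_, ?_⟩
  · obtain ⟨i, hi⟩ := Function.ne_iff.1 hx
    refine Function.ne_iff.2 ⟨⟨Pi.single i (macaulayDegree d), by simp⟩, ?_⟩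
    refine Finset.prod_ne_zero_iff.2 fun k _ => ?_
    by_cases hk : k = i
    · subst hk
      exact pow_ne_zero _ hi
    · simp [Pi.single_eq_of_ne hk]
  · ext β
    have hrow : ∀ α : Mono m (d (macaulayIndex j β)),
        ∑ γ : Mono m (macaulayDegree d), (if α.1 + macaulayQuotient j β = γ.1 then
          c ⟨macaulayIndex j β, α⟩ else 0) * ∏ k, x k ^ γ.1 k =
        (c ⟨macaulayIndex j β, α⟩ * ∏ k, x k ^ α.1 k) * ∏ k, x k ^ macaulayQuotient j β k := by
      intro α
      rw [Finset.sum_eq_single ⟨_, sum_add_macaulayQuotient j β α⟩]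
      · simp [pow_add, Finset.prod_mul_distrib, mul_assoc]
      · intro γ _ hγ
        rw [if_neg fun h => hγ (Subtype.ext h.symm), zero_mul]
      · simp
    calc _ = ∑ γ : Mono m (macaulayDegree d), ∑ α : Mono m (d (macaulayIndex j β)),
          (if α.1 + macaulayQuotient j β = γ.1 then
            c ⟨macaulayIndex j β, α⟩ else 0) * ∏ k, x k ^ γ.1 k := by
          simp only [Matrix.mulVec, dotProduct, Matrix.map_apply, macaulayMatrix, Matrix.of_apply,
            map_sum, apply_ite (eval c), eval_X, map_zero, Finset.sum_mul]
      _ = 0 := by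
          rw [Finset.sum_comm, Finset.sum_congr rfl fun α _ => hrow α, ← Finset.sum_mul, h,
            zero_mul]

theorem det_macaulayMatrix_ne_zero (j : Fin m) : (macaulayMatrix (d := d) j).det ≠ 0 := by
  intro h0
  have h1 := eval_det_macaulayMatrix j
    (fun v : CoeffIdx m d => if v.2.1 = Pi.single v.1 (d v.1) then (1 : ℂ) else 0)
  have hone : (macaulayMatrix j).map (eval
      (fun v : CoeffIdx m d => if v.2.1 = Pi.single v.1 (d v.1) then (1 : ℂ) else 0)) = 1 := by
    ext β γ
    simp only [Matrix.map_apply, macaulayMatrix, Matrix.of_apply, map_sum, apply_ite (eval _),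
      eval_X, map_zero]
    rw [Finset.sum_eq_single
      ⟨Pi.single (macaulayIndex j β) (d (macaulayIndex j β)), by simp⟩]
    · simp only [single_add_macaulayQuotient, if_true, Matrix.one_apply, Subtype.ext_iff]
    · intro α _ hα
      rw [if_neg fun h => hα (Subtype.ext h), ite_self]
    · simp
  rw [hone, h0, map_zero, Matrix.det_one] at h1
  exact zero_ne_one h1

end Macaulay

section Resultant

variable {m : ℕ} {d : Fin m → ℕ}

theorem resEval_eq_eval_map (F : Fin m → MvPolynomial (Fin m) ℂ)
    (R : MvPolynomial (CoeffIdx m d) ℤ) :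
    resEval d F R = eval (fun v => coeff v.2.toFinsupp (F v.1)) (map (Int.castRingHom ℂ) R) :=
  (eval_map _ _ _).symm

theorem Mono.toFinsupp_injective {e : ℕ} :
    Function.Injective (Mono.toFinsupp : Mono m e → Fin m →₀ ℕ) := fun _ _ h =>
  Subtype.ext (Finsupp.equivFunOnFinite.symm.injective h)

/-- The form of degree `e` with coefficients `c`. -/
noncomputable def formOfCoeffs {e : ℕ} (c : Mono m e → ℂ) : MvPolynomial (Fin m) ℂ :=
  ∑ α : Mono m e, monomial α.toFinsupp (c α)

theorem isHomogeneous_formOfCoeffs {e : ℕ} (c : Mono m e → ℂ) :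
    (formOfCoeffs c).IsHomogeneous e := by
  refine IsHomogeneous.sum _ _ _ fun α _ => isHomogeneous_monomial _ ?_
  rw [Finsupp.degree_eq_sum]
  exact α.2

theorem coeff_formOfCoeffs {e : ℕ} (c : Mono m e → ℂ) (α : Mono m e) :
    coeff α.toFinsupp (formOfCoeffs c) = c α := by
  rw [formOfCoeffs, coeff_sum, Finset.sum_eq_single α]
  · simp
  · intro β _ hβ
    rw [coeff_monomial, if_neg fun h => hβ (Mono.toFinsupp_injective h)]
  · simp

theorem eval_formOfCoeffs {e : ℕ} (c : Mono m e → ℂ) (x : Fin m → ℂ) :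
    eval x (formOfCoeffs c) = ∑ α : Mono m e, c α * ∏ k, x k ^ α.1 k := by
  rw [formOfCoeffs, map_sum]
  refine Finset.sum_congr rfl fun α _ => ?_
  rw [eval_monomial, Finsupp.prod_fintype _ _ (by simp)]
  rfl

theorem IsResultant.map_dvd_det_macaulayMatrix {R : MvPolynomial (CoeffIdx m d) ℤ}
    (hR : IsResultant m d R) (j : Fin m) :
    map (Int.castRingHom ℂ) R ∣ (macaulayMatrix (d := d) j).det := by
  refine dvd_of_irreducible_of_forall_eval_eq_zero hR.2.2.1 fun c hc => ?_
  obtain ⟨x, hx, hxF⟩ := (hR.1 (fun i => formOfCoeffs fun α => c ⟨i, α⟩)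
    fun i => isHomogeneous_formOfCoeffs _).2 (by
      simpa only [resEval_eq_eval_map, coeff_formOfCoeffs] using hc)
  exact eval_det_macaulayMatrix_eq_zero j c hx fun i => by
    rw [← eval_formOfCoeffs]; exact hxF i

/-- If `R` vanishes at `N` members of a pencil `t A_j + B_j` in the block `j`, but not at all
of them, then the degree of `R` in this block is at least `N`. -/
theorem card_le_of_block_degree_le {R : MvPolynomial (CoeffIdx m d) ℤ} (j : Fin m) (D : ℕ)
    (hD : ∀ μ ∈ (map (Int.castRingHom ℂ) R).support,
      ∑ v ∈ Finset.univ.filter (fun v : CoeffIdx m d => v.1 = j), μ v ≤ D)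
    (A : MvPolynomial (Fin m) ℂ) (B : Fin m → MvPolynomial (Fin m) ℂ) (T : Finset ℂ)
    (hT : ∀ t ∈ T, resEval d (fun i => C t * (if i = j then A else 0) + B i) R = 0) {t₀ : ℂ}
    (ht₀ : resEval d (fun i => C t₀ * (if i = j then A else 0) + B i) R ≠ 0) : T.card ≤ D := by
  set q : CoeffIdx m d → Polynomial ℂ := fun v =>
    Polynomial.C (coeff v.2.toFinsupp (if v.1 = j then A else 0)) * Polynomial.X +
      Polynomial.C (coeff v.2.toFinsupp (B v.1))
  set g := aeval q (map (Int.castRingHom ℂ) R)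
  have hg : ∀ t, g.eval t =
      resEval d (fun i => C t * (if i = j then A else 0) + B i) R := by
    intro t
    rw [resEval_eq_eval_map, ← aeval_eq_eval, ← Polynomial.coe_aeval_eq_eval, ← AlgHom.comp_apply, comp_aeval]
    have hq : (fun v => Polynomial.aeval t (q v)) = fun v =>
        coeff v.2.toFinsupp (C t * (if v.1 = j then A else 0) + B v.1) := by
      funext v
      rw [coeff_add, coeff_C_mul, Polynomial.coe_aeval_eq_eval, Polynomial.eval_add,
        Polynomial.eval_mul, Polynomial.eval_C, Polynomial.eval_X, Polynomial.eval_C, mul_comm]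
    rw [hq]
  have hg0 : g ≠ 0 := by
    rintro h
    exact ht₀ (by rw [← hg, h, Polynomial.eval_zero])
  have hdeg : g.natDegree ≤ D := by
    refine natDegree_aeval_le_of_block_degree_le _ _ D hD q fun v => ?_
    by_cases hv : v.1 = j
    · rw [if_pos (by simpa using hv)]
      exact Polynomial.natDegree_linear_le
    · simp [q, hv]
  refine le_trans ?_ hdeg
  refine Polynomial.card_le_degree_of_subset_roots (p := g) fun t ht => ?_
  rw [Polynomial.mem_roots hg0, Polynomial.IsRoot, hg]
  exact hT t ht

theorem IsResultant.prod_le_block_degree (hd : ∀ i, 0 < d i) {R : MvPolynomial (CoeffIdx m d) ℤ}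
    (hR : IsResultant m d R) (j : Fin m) (D : ℕ)
    (hD : ∀ μ ∈ (map (Int.castRingHom ℂ) R).support,
      ∑ v ∈ Finset.univ.filter (fun v : CoeffIdx m d => v.1 = j), μ v ≤ D) :
    ∏ i ∈ Finset.univ.erase j, d i ≤ D := by
  set e : Fin m → ℕ := Function.update d j 1
  have hej : e j = 1 := by simp [e]
  have hei : ∀ i, i ≠ j → e i = d i := fun i hi => by simp [e, hi]
  have hprod : ∏ i, e i = ∏ i ∈ Finset.univ.erase j, d i := by
    rw [← Finset.mul_prod_erase _ _ (Finset.mem_univ j), hej, one_mul]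
    exact Finset.prod_congr rfl fun i hi => hei i (Finset.ne_of_mem_erase hi)
  set w : Fin m → ℕ := fun i => ∏ k : Fin i, e (Fin.castLE i.is_lt.le k)
  set B : Fin m → MvPolynomial (Fin m) ℂ := fun i =>
    if i = j then -((∑ k ∈ Finset.univ.erase j, X k) * X j ^ (d j - 1))
    else ∏ k ∈ Finset.range (d i), (X i - C ((k * w i : ℕ) : ℂ) * X j)
  set F : ℂ → Fin m → MvPolynomial (Fin m) ℂ := fun t i =>
    C t * (if i = j then X j ^ d j else 0) + B i
  have hFj : ∀ t, F t j = C t * X j ^ d j - (∑ k ∈ Finset.univ.erase j, X k) * X j ^ (d j - 1) := by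
    intro t
    simp [F, B, sub_eq_add_neg]
  have hFi : ∀ t i, i ≠ j → F t i =
      ∏ k ∈ Finset.range (d i), (X i - C ((k * w i : ℕ) : ℂ) * X j) := by
    intro t i hi
    simp [F, B, hi]
  have hhom : ∀ t i, (F t i).IsHomogeneous (d i) := by
    intro t i
    by_cases hi : i = j
    · subst hi
      rw [hFj]
      refine IsHomogeneous.sub ?_ ?_
      · simpa using (isHomogeneous_C (Fin m) t).mul (isHomogeneous_X_pow i (d i))
      · have h := (IsHomogeneous.sum (Finset.univ.erase i) (fun k => (X k : MvPolynomial (Fin m) ℂ))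
          1 fun k _ => isHomogeneous_X _ k).mul (isHomogeneous_X_pow (R := ℂ) i (d i - 1))
        rwa [Nat.add_sub_cancel' (hd i)] at h
    · rw [hFi t i hi]
      have h := IsHomogeneous.prod (Finset.range (d i))
        (fun k => (X i - C ((k * w i : ℕ) : ℂ) * X j : MvPolynomial (Fin m) ℂ)) (fun _ => 1)
        fun k _ => (isHomogeneous_X ℂ i).sub (by
          simpa using (isHomogeneous_C (Fin m) ((k * w i : ℕ) : ℂ)).mul (isHomogeneous_X ℂ j))
      simpa using h
  have hcard : ((Finset.range (∏ i, e i)).map (Nat.castEmbedding (R := ℂ))).card = ∏ i, e i := by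
    rw [Finset.card_map, Finset.card_range]
  rw [← hprod, ← hcard]
  refine card_le_of_block_degree_le (R := R) j D hD (X j ^ d j) B _ ?_ (t₀ := -1) ?_
  · intro t ht
    obtain ⟨N, hN, rfl⟩ := Finset.mem_map.1 ht
    refine (hR.1 (F N) (hhom N)).1 ?_
    obtain ⟨f, hf⟩ := finPiFinEquiv.surjective (⟨N, Finset.mem_range.1 hN⟩ : Fin (∏ i, e i))
    have hfN : N = ∑ i ∈ Finset.univ.erase j, (f i : ℕ) * w i := by
      have h := congrArg Fin.val hf
      rw [finPiFinEquiv_apply, ← Finset.add_sum_erase _ _ (Finset.mem_univ j)] at h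
      have hfj : (f j : ℕ) = 0 := by
        have := (f j).2
        omega
      rw [hfj, zero_mul, zero_add] at h
      exact h.symm
    refine ⟨Function.update (fun i => ((f i * w i : ℕ) : ℂ)) j 1,
      Function.ne_iff.2 ⟨j, by simp⟩, fun i => ?_⟩
    by_cases hi : i = j
    · subst hi
      rw [hFj]
      simp only [map_sub, map_mul, map_pow, map_sum, eval_C, eval_X, Function.update_self, one_pow,
        mul_one]
      rw [sub_eq_zero, Finset.sum_congr rfl fun k hk =>
        Function.update_of_ne (Finset.ne_of_mem_erase hk) _ _, ← Nat.cast_sum, ← hfN]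
    · rw [hFi _ i hi, map_prod]
      refine Finset.prod_eq_zero (i := (f i : ℕ)) (Finset.mem_range.2 ?_) ?_
      · rw [← hei i hi]
        exact (f i).2
      · simp [hi]
  · intro h0
    obtain ⟨x, hx, hxF⟩ := (hR.1 (F (-1)) (hhom (-1))).2 h0
    have hroot : ∀ i, i ≠ j → ∃ k : ℕ, x i = (k : ℂ) * x j := by
      intro i hi
      have h := hxF i
      rw [hFi _ i hi, map_prod, Finset.prod_eq_zero_iff] at h
      obtain ⟨k, _, hk⟩ := h
      refine ⟨k * w i, ?_⟩
      simpa [sub_eq_zero] using hk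
    have hxj : x j ≠ 0 := by
      intro hj
      refine hx (funext fun i => ?_)
      by_cases hi : i = j
      · rw [hi, hj, Pi.zero_apply]
      · obtain ⟨k, hk⟩ := hroot i hi
        rw [hk, hj, mul_zero, Pi.zero_apply]
    choose! k hk using hroot
    have h := hxF j
    rw [hFj] at h
    simp only [map_sub, map_mul, map_pow, map_sum, eval_C, eval_X] at h
    rw [Finset.sum_congr rfl fun i hi => hk i (Finset.ne_of_mem_erase hi), ← Finset.sum_mul,
      ← Nat.cast_sum, mul_assoc, ← pow_succ', Nat.sub_add_cancel (hd j), ← sub_mul,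
      mul_eq_zero, or_iff_left (pow_ne_zero _ hxj)] at h
    have h' : ((∑ i ∈ Finset.univ.erase j, k i + 1 : ℕ) : ℂ) = 0 := by
      push_cast at h ⊢
      linear_combination -h
    exact Nat.succ_ne_zero _ (Nat.cast_eq_zero.1 h')

theorem IsResultant.block_degree (hd : ∀ i, 0 < d i) {R : MvPolynomial (CoeffIdx m d) ℤ}
    (hR : IsResultant m d R) (j : Fin m) {μ : CoeffIdx m d →₀ ℕ} (hμ : μ ∈ R.support) :
    ∑ v ∈ Finset.univ.filter (fun v : CoeffIdx m d => v.1 = j), μ v =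
      ∏ i ∈ Finset.univ.erase j, d i := by
  obtain ⟨D, hDle, hD⟩ := exists_block_degree_of_dvd _ (det_macaulayMatrix_ne_zero j)
    (blockGrading_det_macaulayMatrix j) (hR.map_dvd_det_macaulayMatrix j)
  have h1 := hDle.trans (card_macaulayIndex_eq_le j)
  have h2 := hR.prod_le_block_degree hd j D fun ν hν => (hD ν hν).le
  rw [← support_map_of_injective R (Int.castRingHom ℂ).injective_int] at hμ
  rw [hD μ hμ]
  exact le_antisymm h1 h2

end Resultant

/-- Homogeneity of the resultant: for each fixed `j`, `Res_{d_0,…,d_n}` is homogeneous in the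
block of variables `u_{j,α}`, `|α| = d j`, of degree `∏_{i ≠ j} d i`; hence its total degree is
`∑_j ∏_{i ≠ j} d i`. -/
theorem resultant_homogeneous_in_block (n : ℕ) (d : Fin (n + 1) → ℕ) (hd : ∀ i, 0 < d i)
    (R : MvPolynomial (CoeffIdx (n + 1) d) ℤ) (hR : IsResultant (n + 1) d R) :
    (∀ j : Fin (n + 1), ∀ μ ∈ R.support,
        ∑ v ∈ Finset.univ.filter (fun v : CoeffIdx (n + 1) d => v.1 = j), μ v =
          ∏ i ∈ Finset.univ.erase j, d i) ∧
    R.totalDegree = ∑ j : Fin (n + 1), ∏ i ∈ Finset.univ.erase j, d i := by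
  have hblock : ∀ j : Fin (n + 1), ∀ μ ∈ R.support,
      ∑ v ∈ Finset.univ.filter (fun v : CoeffIdx (n + 1) d => v.1 = j), μ v =
        ∏ i ∈ Finset.univ.erase j, d i := fun j μ hμ => hR.block_degree hd j hμ
  refine ⟨hblock, ?_⟩
  have htotal : ∀ μ ∈ R.support, (μ.sum fun _ e => e) = ∑ j, ∏ i ∈ Finset.univ.erase j, d i := by
    intro μ hμ
    rw [Finsupp.sum_fintype _ _ fun _ => rfl,
      ← Finset.sum_fiberwise Finset.univ (fun v : CoeffIdx (n + 1) d => v.1)]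
    exact Finset.sum_congr rfl fun j _ => hblock j μ hμ
  rw [totalDegree, Finset.sup_congr rfl htotal,
    Finset.sup_const (support_nonempty.2 hR.2.1.ne_zero)]
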